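/- arXiv:math/0505643 — 2 statements merged into one kernel-verified Lean document; each statement's English description precedes it below -/
import Mathlib

section
/- For every integer L ≥ 2, every φ ∈ ℤ^L, each sign * ∈ {+,−}, and every z ∈ 1/2 + ℤ, the set of *-unstable points of Δ(φ) on the vertical line r(z) = {(x,y) ∈ ℝ²: x = z} has cardinality at most 2: |I^*(Δ(φ)) ∩ r(z)| ≤ 2. -/
open scoped BigOperators

/-- Configurations of the interface: integer heights indexed by `Fin L`. -/
abbrev Cfg (L : ℕ) := Fin L → ℤ

/-- The point of `ℝ²` corresponding to the dual-lattice site `p ∈ (ℤ²)* = (1/2,1/2)+ℤ²`. -/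
noncomputable def ptR (p : ℤ × ℤ) : ℝ × ℝ := ((p.1 : ℝ) + 1/2, (p.2 : ℝ) + 1/2)

/-- Euclidean distance on `ℝ²` (realized as pairs). -/
noncomputable def rdist (a b : ℝ × ℝ) : ℝ :=
  Real.sqrt ((a.1 - b.1)^2 + (a.2 - b.2)^2)

/-- Adjacency of dual sites: Euclidean distance one. -/
def dualAdj (p q : ℤ × ℤ) : Prop := (p.1 - q.1)^2 + (p.2 - q.2)^2 = 1

/-- A finite set of dual sites is connected in the nearest-neighbour graph of `(ℤ²)*`. -/
def IsConn (Λ : Finset (ℤ × ℤ)) : Prop :=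
  Λ.Nonempty ∧ ∀ p ∈ Λ, ∀ q ∈ Λ,
    Relation.ReflTransGen (fun a b => a ∈ Λ ∧ b ∈ Λ ∧ dualAdj a b) p q

/-- Euclidean diameter of a finite set of dual sites. -/
noncomputable def fdiam (Λ : Finset (ℤ × ℤ)) : ℝ :=
  sSup {d : ℝ | ∃ p ∈ Λ, ∃ q ∈ Λ, d = rdist (ptR p) (ptR q)}

/-- A translation-invariant potential on finite connected subsets of the dual lattice,
with exponentially decaying long range part:  there are `β₀ > 0` and `m` with
`m β → ∞` such that for `β > β₀` the sum of `|Φ β Λ|` over connected `Λ ∋ p` of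
diameter `≥ k` is at most `exp (-(m β) k)` (and the full sum over `Λ ∋ p` converges
absolutely). -/
structure Potential where
  Φ : ℝ → Finset (ℤ × ℤ) → ℝ
  β₀ : ℝ
  m : ℝ → ℝ
  β₀_pos : 0 < β₀
  m_pos : ∀ β, β₀ < β → 0 < m β
  m_tendsto : Filter.Tendsto m Filter.atTop Filter.atTop
  trans_inv : ∀ β (v : ℤ × ℤ) (Λ : Finset (ℤ × ℤ)),
    Φ β (Λ.image (fun p => p + v)) = Φ β Λ
  abs_summable : ∀ β, β₀ < β → ∀ p : ℤ × ℤ,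
    Summable (fun Λ : {Λ : Finset (ℤ × ℤ) // IsConn Λ ∧ p ∈ Λ} => |Φ β Λ.1|)
  decay : ∀ β, β₀ < β → ∀ k : ℝ, 0 < k → ∀ p : ℤ × ℤ,
    (∑' Λ : {Λ : Finset (ℤ × ℤ) // IsConn Λ ∧ p ∈ Λ ∧ k ≤ fdiam Λ}, |Φ β Λ.1|)
      ≤ Real.exp (-(m β) * k)

/-- The contour `Γ(φ) ⊆ ℝ²` associated with a configuration `φ` (0-based indexing:
the horizontal segment over `(i, i+1)` is at height `φ i`, and the vertical segment
at `x = i+1` joins `φ i` and `φ (i+1)`). -/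
def contour (L : ℕ) (φ : Cfg L) : Set (ℝ × ℝ) :=
  {a | (∃ i : Fin L, a.2 = (φ i : ℝ) ∧ ((i : ℕ) : ℝ) < a.1 ∧ a.1 < ((i : ℕ) : ℝ) + 1) ∨
       (∃ i : Fin L, ∃ h : (i : ℕ) + 1 < L,
          a.1 = ((i : ℕ) : ℝ) + 1 ∧
          min (φ i : ℝ) (φ ⟨(i : ℕ) + 1, h⟩ : ℝ) ≤ a.2 ∧
          a.2 ≤ max (φ i : ℝ) (φ ⟨(i : ℕ) + 1, h⟩ : ℝ))}

/-- Euclidean distance from a point to a subset of `ℝ²`. -/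
noncomputable def distToSet (a : ℝ × ℝ) (S : Set (ℝ × ℝ)) : ℝ := sInf (rdist a '' S)

/-- The set `Δ(φ)` of dual sites attached to the contour `Γ(φ)`. -/
noncomputable def Delta (L : ℕ) (φ : Cfg L) : Set (ℤ × ℤ) :=
  {p | distToSet (ptR p) (contour L φ) = 1/2 ∨
       distToSet (ptR p) (contour L φ) = 1 / Real.sqrt 2}

/-- The infinite vertical strip `V_L^∞ = ([-1/2, L+1/2] × ℝ) ∩ (ℤ²)*`. -/
def VInf (L : ℕ) : Set (ℤ × ℤ) :=
  {p | -(1/2 : ℝ) ≤ (ptR p).1 ∧ (ptR p).1 ≤ (L : ℝ) + 1/2}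

/-- The box `V_L^M = ([-1/2, L+1/2] × [-(M+1)/2, (M+1)/2]) ∩ (ℤ²)*`. -/
def VM (L : ℕ) (M : ℝ) : Set (ℤ × ℤ) :=
  {p | -(1/2 : ℝ) ≤ (ptR p).1 ∧ (ptR p).1 ≤ (L : ℝ) + 1/2 ∧ |(ptR p).2| ≤ (M + 1) / 2}

/-- Sum of the potential over connected subsets of `V` meeting `D`. -/
noncomputable def Wsum (P : Potential) (β : ℝ) (V D : Set (ℤ × ℤ)) : ℝ :=
  ∑' Λ : {Λ : Finset (ℤ × ℤ) // IsConn Λ ∧ ↑Λ ⊆ V ∧ ∃ p ∈ Λ, p ∈ D}, P.Φ β Λ.1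

/-- `W_L^∞(β, φ)`. -/
noncomputable def WInf (P : Potential) (β : ℝ) (L : ℕ) (φ : Cfg L) : ℝ :=
  Wsum P β (VInf L) (Delta L φ)

/-- `W_L^M(β, φ)`. -/
noncomputable def WM (P : Potential) (β : ℝ) (L : ℕ) (M : ℝ) (φ : Cfg L) : ℝ :=
  Wsum P β (VM L M) (Delta L φ)

/-- The local SOS energy `H_L(φ) = ∑_{k=1}^{L-1} |φ_{k+1} - φ_k|`. -/
def Hloc (L : ℕ) (φ : Cfg L) : ℤ :=
  ∑ i : Fin L, if h : (i : ℕ) + 1 < L then |φ ⟨(i : ℕ) + 1, h⟩ - φ i| else 0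

/-- The first coordinate of a configuration. -/
def first (L : ℕ) (φ : Cfg L) : ℤ := if h : 0 < L then φ ⟨0, h⟩ else 0

/-- `upd φ k s = φ + s·δ_k`. -/
def upd {L : ℕ} (φ : Cfg L) (k : Fin L) (s : ℤ) : Cfg L :=
  fun i => if i = k then φ i + s else φ i

/-- Normalization of a weight. -/
noncomputable def Zsum {L : ℕ} (w : Cfg L → ℝ) : ℝ := ∑' φ : Cfg L, w φ

/-- Expectation of `f` under the probability measure proportional to the weight `w`. -/
noncomputable def expect {L : ℕ} (w f : Cfg L → ℝ) : ℝ :=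
  (∑' φ : Cfg L, w φ * f φ) / Zsum w

/-- Variance of `f` under the probability measure proportional to the weight `w`. -/
noncomputable def varOf {L : ℕ} (w f : Cfg L → ℝ) : ℝ :=
  expect w (fun φ => (f φ)^2) - (expect w f)^2

/-- Probability of the event `E` under the measure proportional to the weight `w`. -/
noncomputable def prOf {L : ℕ} (w : Cfg L → ℝ) (E : Cfg L → Prop) : ℝ :=
  (∑' φ : {φ : Cfg L // E φ}, w φ.1) / Zsum w

/-- Unnormalized weight of the auxiliary measure `μ̄_L^M`. -/
noncomputable def muBarW (P : Potential) (β : ℝ) (L : ℕ) (M : ℝ) (φ : Cfg L) : ℝ :=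
  (if |(first L φ : ℝ)| ≤ M then 1 else 0) *
    Real.exp (-β * (Hloc L φ : ℝ) - WInf P β L φ)

/-- The probability mass function of `μ̄_L^M`. -/
noncomputable def muBar (P : Potential) (β : ℝ) (L : ℕ) (M : ℝ) (φ : Cfg L) : ℝ :=
  muBarW P β L M φ / Zsum (muBarW P β L M)

/-- Jump rates `c̄_L^M(φ, ψ)` of the auxiliary dynamics. -/
noncomputable def cBar (P : Potential) (β : ℝ) (L : ℕ) (M : ℝ) (φ ψ : Cfg L) : ℝ :=
  if 0 < muBarW P β L M φ then Real.sqrt (muBarW P β L M ψ / muBarW P β L M φ) else 0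

/-- The Dirichlet form `𝓖̄_L^M(f,f)` of the auxiliary Glauber dynamics. -/
noncomputable def dirForm (P : Potential) (β : ℝ) (L : ℕ) (M : ℝ) (f : Cfg L → ℝ) : ℝ :=
  (1/2) * ∑ k : Fin L, ∑' φ : Cfg L,
    muBar P β L M φ *
      (cBar P β L M φ (upd φ k 1) * (f (upd φ k 1) - f φ)^2 +
       cBar P β L M φ (upd φ k (-1)) * (f (upd φ k (-1)) - f φ)^2)

/-- Unnormalized weight of the measure `μ_L^{L/2}` in the box of size `L`. -/
noncomputable def muW (P : Potential) (β : ℝ) (L : ℕ) (φ : Cfg L) : ℝ :=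
  (if ∀ i, |(φ i : ℝ)| ≤ (L : ℝ) / 2 then 1 else 0) *
    Real.exp (-β * (Hloc L φ : ℝ) - WM P β L ((L : ℝ) / 2) φ)

/-- Jump rates `c_L^{L/2}(φ, ψ)` of the dynamics in the box. -/
noncomputable def cFull (P : Potential) (β : ℝ) (L : ℕ) (φ ψ : Cfg L) : ℝ :=
  if 0 < muW P β L φ then Real.sqrt (muW P β L ψ / muW P β L φ) else 0

/-- The region `A = {φ : max_i |φ_i| ≤ (1-ε)L/2}`. -/
def Aset (L : ℕ) (ε : ℝ) : Set (Cfg L) :=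
  {φ | ∀ i, |(φ i : ℝ)| ≤ (1 - ε) * L / 2}

/-- The map `T(η) = (η₁, η₁+η₂, …, η₁+⋯+η_L)`. -/
def Tmap {L : ℕ} (η : Cfg L) : Cfg L := fun i => ∑ j ∈ Finset.Iic i, η j

/-- Unnormalized weight of the gradient measure `ν̄_L^M`. -/
noncomputable def nuBarMW (P : Potential) (β : ℝ) (L : ℕ) (M : ℝ) (η : Cfg L) : ℝ :=
  (if |(first L η : ℝ)| ≤ M then 1 else 0) *
    Real.exp (-β * (∑ i : Fin L, if 0 < (i : ℕ) then (|η i| : ℝ) else 0)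
      - WInf P β L (Tmap η))

/-- The Kawasaki-type quadratic form `𝓔̄_L^M(f,f)`. -/
noncomputable def kawForm (P : Potential) (β : ℝ) (L : ℕ) (M : ℝ) (f : Cfg L → ℝ) : ℝ :=
  expect (nuBarMW P β L M) (fun η =>
    if h : 1 < L then
      (if (first L η : ℝ) < M then 1 else 0) *
        (f (upd (upd η ⟨1, h⟩ 1) ⟨0, by omega⟩ (-1)) - f η)^2
    else 0) +
  (∑ k : Fin L, if h : 0 < (k : ℕ) ∧ (k : ℕ) + 1 < L then
      expect (nuBarMW P β L M)
        (fun η => (f (upd (upd η ⟨(k : ℕ) + 1, h.2⟩ 1) k (-1)) - f η)^2)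
    else 0) +
  (if h : 0 < L then
      expect (nuBarMW P β L M)
        (fun η => (f (upd η ⟨L - 1, by omega⟩ 1) - f η)^2)
    else 0)

/-- `ψ(η) ∈ ℤ^{L+1}`: `ψ(η)₁ = 0` and `ψ(η)_{k+1} = η₁ + ⋯ + η_k`. -/
def psiMap {L : ℕ} (η : Cfg L) : Cfg (L + 1) :=
  fun i => ∑ j : Fin L, if (j : ℕ) < (i : ℕ) then η j else 0

/-- Unnormalized weight of the measure `ν̄_L` (with hatted interaction `Ŵ_L`). -/
noncomputable def nuHatW (P : Potential) (β : ℝ) (L : ℕ) (η : Cfg L) : ℝ :=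
  Real.exp (-β * (∑ i : Fin L, (|η i| : ℝ)) - WInf P β (L + 1) (psiMap η))

/-- Conditional expectation of `f` given the coordinates in `S` (evaluated at `η`),
under the measure proportional to `w`. -/
noncomputable def condExp {L : ℕ} (w : Cfg L → ℝ) (S : Set (Fin L))
    (f : Cfg L → ℝ) (η : Cfg L) : ℝ :=
  (∑' ζ : {ζ : Cfg L // ∀ i ∈ S, ζ i = η i}, w ζ.1 * f ζ.1) /
  (∑' ζ : {ζ : Cfg L // ∀ i ∈ S, ζ i = η i}, w ζ.1)

/-- Conditional variance given the coordinates in `S`. -/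
noncomputable def condVar {L : ℕ} (w : Cfg L → ℝ) (S : Set (Fin L))
    (f : Cfg L → ℝ) (η : Cfg L) : ℝ :=
  condExp w S (fun ζ => (f ζ)^2) η - (condExp w S f η)^2

/-- Conditional covariance given the coordinates in `S`. -/
noncomputable def condCov {L : ℕ} (w : Cfg L → ℝ) (S : Set (Fin L))
    (f g : Cfg L → ℝ) (η : Cfg L) : ℝ :=
  condExp w S (fun ζ => f ζ * g ζ) η - condExp w S f η * condExp w S g η

/-- Conditional probability that coordinate `j` equals `v`, given the coordinates
strictly above `j` (their values being read off from `η`). -/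
noncomputable def condProbAbove {L : ℕ} (w : Cfg L → ℝ) (j : Fin L) (v : ℤ)
    (η : Cfg L) : ℝ :=
  condExp w {i | j < i} (fun ζ => if ζ j = v then 1 else 0) η

/-- `+`unstable points of a set of dual sites: `p ∈ S` with `p ∉ S + e_y`. -/
def Iplus (S : Set (ℤ × ℤ)) : Set (ℤ × ℤ) := {p | p ∈ S ∧ (p.1, p.2 - 1) ∉ S}

/-- `−`unstable points of a set of dual sites: `p ∈ S` with `p ∉ S - e_y`. -/
def Iminus (S : Set (ℤ × ℤ)) : Set (ℤ × ℤ) := {p | p ∈ S ∧ (p.1, p.2 + 1) ∉ S}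

/-- Sum of `Φ(β,Λ)` over `Λ ∈ S(φ)` entirely contained in the half plane `x > j`. -/
noncomputable def tailW (P : Potential) (β : ℝ) (L : ℕ) (j : ℕ) (φ : Cfg L) : ℝ :=
  ∑' Λ : {Λ : Finset (ℤ × ℤ) // IsConn Λ ∧ ↑Λ ⊆ VInf L ∧ (∃ p ∈ Λ, p ∈ Delta L φ) ∧
      ∀ p ∈ Λ, (j : ℝ) < (ptR p).1}, P.Φ β Λ.1

/-- `Ŵ_j(β,φ)`: sum of `Φ(β,Λ)` over `Λ ∈ S_j(φ)`, i.e. connected `Λ ⊆ V_L^∞` meeting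
`Δ(φ)` and not entirely contained in the half plane `x > j`. -/
noncomputable def Wj (P : Potential) (β : ℝ) (L : ℕ) (j : ℕ) (φ : Cfg L) : ℝ :=
  ∑' Λ : {Λ : Finset (ℤ × ℤ) // IsConn Λ ∧ ↑Λ ⊆ VInf L ∧ (∃ p ∈ Λ, p ∈ Delta L φ) ∧
      ¬(∀ p ∈ Λ, (j : ℝ) < (ptR p).1)}, P.Φ β Λ.1

/-- Increment vector `(0, φ₂-φ₁, …, φ_L-φ_{L-1})` of a configuration. -/
def incr {L : ℕ} (φ : Cfg L) : Cfg L :=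
  fun i => if h : 0 < (i : ℕ) then
    φ i - φ ⟨(i : ℕ) - 1, lt_of_le_of_lt (Nat.sub_le _ _) i.isLt⟩ else 0

/-- The heights `φ`, extended to all of `ℤ` by the boundary values. -/
def extHeight {L : ℕ} (hL : 0 < L) (φ : Cfg L) (k : ℤ) : ℤ :=
  φ ⟨min k.toNat (L - 1), by omega⟩

/-- Lowest height of the closed contour on the line `x = k`. -/
def lineLo {L : ℕ} (hL : 0 < L) (φ : Cfg L) (k : ℤ) : ℤ :=
  min (extHeight hL φ (k - 1)) (extHeight hL φ k)

/-- Highest height of the closed contour on the line `x = k`. -/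
def lineHi {L : ℕ} (hL : 0 < L) (φ : Cfg L) (k : ℤ) : ℤ :=
  max (extHeight hL φ (k - 1)) (extHeight hL φ k)

lemma extHeight_coe {L : ℕ} (hL : 0 < L) (φ : Cfg L) (i : Fin L) :
    extHeight hL φ (i : ℕ) = φ i := by
  unfold extHeight
  congr 1
  ext
  simp
  omega

lemma mem_contour_iff {L : ℕ} (hL : 0 < L) (φ : Cfg L) (a : ℝ × ℝ) :
    a ∈ contour L φ ↔
      (∃ k : ℤ, 0 ≤ k ∧ k < L ∧ a.2 = extHeight hL φ k ∧ (k : ℝ) < a.1 ∧ a.1 < k + 1) ∨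
      (∃ k : ℤ, 1 ≤ k ∧ k < L ∧ a.1 = k ∧
        (lineLo hL φ k : ℝ) ≤ a.2 ∧ a.2 ≤ lineHi hL φ k) := by
  have step : ∀ (i : Fin L) (h : (i : ℕ) + 1 < L),
      extHeight hL φ (((i : ℕ) : ℤ) + 1) = φ ⟨(i : ℕ) + 1, h⟩ := fun i h => by
    simpa using extHeight_coe hL φ ⟨(i : ℕ) + 1, h⟩
  constructor
  · rintro (⟨i, h1, h2, h3⟩ | ⟨i, h, h1, h2, h3⟩)
    · exact Or.inl ⟨(i : ℕ), by omega, by omega, by rw [extHeight_coe]; exact h1,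
        by simpa using h2, by simpa using h3⟩
    · refine Or.inr ⟨(i : ℕ) + 1, by omega, by omega, by simpa using h1, ?_, ?_⟩
      · simpa [lineLo, step i h, extHeight_coe] using h2
      · simpa [lineHi, step i h, extHeight_coe] using h3
  · rintro (⟨k, hk0, hk, h1, h2, h3⟩ | ⟨k, hk0, hk, h1, h2, h3⟩)
    · lift k to ℕ using hk0
      have hk' : k < L := by omega
      have e := extHeight_coe hL φ ⟨k, hk'⟩
      simp only at e
      exact Or.inl ⟨⟨k, hk'⟩, by rw [h1, e], by simpa using h2, by simpa using h3⟩
    · obtain ⟨n, rfl⟩ : ∃ n : ℕ, k = n + 1 := ⟨(k - 1).toNat, by omega⟩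
      have hn : n + 1 < L := by omega
      have e := extHeight_coe hL φ ⟨n, by omega⟩
      have e' := step ⟨n, by omega⟩ hn
      simp only at e e'
      refine Or.inr ⟨⟨n, by omega⟩, hn, by simpa using h1, ?_, ?_⟩
      · simpa [lineLo, e, e'] using h2
      · simpa [lineHi, e, e'] using h3

lemma distToSet_le {a b : ℝ × ℝ} {S : Set (ℝ × ℝ)} (hb : b ∈ S) :
    distToSet a S ≤ rdist a b :=
  csInf_le ⟨0, by rintro _ ⟨c, -, rfl⟩; exact Real.sqrt_nonneg _⟩ ⟨b, hb, rfl⟩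

lemma distToSet_nonneg (a : ℝ × ℝ) (S : Set (ℝ × ℝ)) : 0 ≤ distToSet a S :=
  Real.sInf_nonneg (by rintro _ ⟨c, -, rfl⟩; exact Real.sqrt_nonneg _)

lemma distToSet_le_sqrt {a : ℝ × ℝ} {S : Set (ℝ × ℝ)} {c : ℝ}
    (h : ∀ δ : ℝ, 0 < δ → δ < 1 → ∃ b ∈ S, (a.1 - b.1) ^ 2 + (a.2 - b.2) ^ 2 ≤ c + 2 * δ) :
    distToSet a S ≤ √c := by
  apply Real.le_sqrt_of_sq_le
  refine le_of_forall_pos_le_add fun ε hε => ?_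
  obtain ⟨b, hb, hab⟩ := h (min (ε / 2) (1 / 2)) (by positivity)
    ((min_le_right _ _).trans_lt (by norm_num))
  have h1 := pow_le_pow_left₀ (distToSet_nonneg a S) (distToSet_le hb (a := a)) 2
  rw [rdist, Real.sq_sqrt (by positivity)] at h1
  linarith [min_le_left (ε / 2) (1 / 2 : ℝ)]

lemma sqrt_le_distToSet {a : ℝ × ℝ} {S : Set (ℝ × ℝ)} {c : ℝ} (hS : S.Nonempty)
    (h : ∀ b ∈ S, c ≤ (a.1 - b.1) ^ 2 + (a.2 - b.2) ^ 2) : √c ≤ distToSet a S :=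
  le_csInf (hS.image _) (by rintro _ ⟨b, hb, rfl⟩; exact Real.sqrt_le_sqrt (h b hb))

lemma contour_nonempty {L : ℕ} (hL : 0 < L) (φ : Cfg L) : (contour L φ).Nonempty :=
  ⟨(1 / 2, φ ⟨0, hL⟩), Or.inl ⟨⟨0, hL⟩, rfl, by norm_num, by norm_num⟩⟩

lemma quarter_le_sq_half_sub_int (n m : ℤ) : (1 / 4 : ℝ) ≤ ((n : ℝ) + 1 / 2 - m) ^ 2 := by
  rcases le_or_gt m n with h | h
  · have : (m : ℝ) ≤ n := by exact_mod_cast h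
    nlinarith
  · have : (n : ℝ) + 1 ≤ m := by exact_mod_cast h
    nlinarith

lemma half_le_sq_half_sub_int {n m : ℤ} (h₀ : m ≠ n) (h₁ : m ≠ n + 1) :
    (1 / 2 : ℝ) ≤ ((n : ℝ) + 1 / 2 - m) ^ 2 := by
  rcases lt_or_gt_of_ne h₀ with h | h
  · have : (m : ℝ) + 1 ≤ n := by exact_mod_cast h
    nlinarith
  · have : (n : ℝ) + 1 + 1 ≤ m := by exact_mod_cast (by omega : n + 1 + 1 ≤ m)
    nlinarith

/-- A dual site belongs to `Δ(φ)` iff a corner of its unit cell lies on the closed contour. -/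
lemma mem_Delta_iff {L : ℕ} (hL : 0 < L) (φ : Cfg L) (p : ℤ × ℤ) :
    p ∈ Delta L φ ↔ ∃ k : ℤ, (k = p.1 ∨ k = p.1 + 1) ∧ 0 ≤ k ∧ k ≤ L ∧
      lineLo hL φ k - 1 ≤ p.2 ∧ p.2 ≤ lineHi hL φ k := by
  obtain ⟨z, y⟩ := p
  have hhalf : √(1 / 4 : ℝ) = 1 / 2 := by
    rw [Real.sqrt_eq_iff_mul_self_eq (by norm_num) (by norm_num)]; norm_num
  have hroot : √(1 / 2 : ℝ) = 1 / √2 := by simp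
  simp only
  constructor
  · intro hp
    have hlt : distToSet (ptR (z, y)) (contour L φ) < 1 := by
      rcases hp with hp | hp <;> rw [hp]
      · norm_num
      · rw [← hroot, Real.sqrt_lt' one_pos]; norm_num
    obtain ⟨_, ⟨a, ha, rfl⟩, hd⟩ :=
      exists_lt_of_csInf_lt ((contour_nonempty hL φ).image _) hlt
    rw [rdist, Real.sqrt_lt' one_pos] at hd
    simp only [ptR] at hd
    have hx := abs_lt_of_sq_lt_sq (by nlinarith : ((z : ℝ) + 1 / 2 - a.1) ^ 2 < 1 ^ 2) one_pos.le
    have hy := abs_lt_of_sq_lt_sq (by nlinarith : ((y : ℝ) + 1 / 2 - a.2) ^ 2 < 1 ^ 2) one_pos.le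
    rw [abs_lt] at hx hy
    rcases (mem_contour_iff hL φ a).1 ha with ⟨k, hk0, hk, h1, h2, h3⟩ | ⟨k, hk0, hk, h1, h2, h3⟩
    · rw [h1] at hy
      have a1 : k < z + 2 := by
        have : (k : ℝ) < z + 2 := by linarith
        exact_mod_cast this
      have a2 : z - 1 < k + 1 := by
        have : (z : ℝ) - 1 < k + 1 := by linarith
        exact_mod_cast this
      have a3 : extHeight hL φ k < y + 2 := by
        have : (extHeight hL φ k : ℝ) < y + 2 := by linarith
        exact_mod_cast this
      have a4 : y < extHeight hL φ k + 1 := by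
        have : (y : ℝ) < extHeight hL φ k + 1 := by linarith
        exact_mod_cast this
      rcases (by omega : k = z - 1 ∨ k = z ∨ k = z + 1) with rfl | rfl | rfl
      · exact ⟨z, .inl rfl, by omega, by omega, by unfold lineLo; omega, by unfold lineHi; omega⟩
      · exact ⟨k, .inl rfl, by omega, by omega, by unfold lineLo; omega, by unfold lineHi; omega⟩
      · exact ⟨z + 1, .inr rfl, by omega, by omega, by unfold lineLo; omega,
          by unfold lineHi; omega⟩
    · rw [h1] at hx
      have a1 : k < z + 2 := by
        have : (k : ℝ) < z + 2 := by linarith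
        exact_mod_cast this
      have a2 : z < k + 1 := by
        have : (z : ℝ) < k + 1 := by linarith
        exact_mod_cast this
      have a3 : lineLo hL φ k < y + 2 := by
        have : (lineLo hL φ k : ℝ) < y + 2 := by linarith
        exact_mod_cast this
      have a4 : y < lineHi hL φ k + 1 := by
        have : (y : ℝ) < lineHi hL φ k + 1 := by linarith
        exact_mod_cast this
      exact ⟨k, by omega, by omega, by omega, by omega, by omega⟩
  · rintro ⟨k, hkz, hk0, hkL, hlo, hhi⟩
    by_cases hedge :
        (0 ≤ z ∧ z < L ∧ (extHeight hL φ z = y ∨ extHeight hL φ z = y + 1)) ∨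
        (∃ j : ℤ, (j = z ∨ j = z + 1) ∧ 1 ≤ j ∧ j < L ∧ lineLo hL φ j ≤ y ∧ y < lineHi hL φ j)
    · refine Or.inl (hhalf ▸ le_antisymm (distToSet_le_sqrt fun δ hδ _ => ?_)
        (sqrt_le_distToSet (contour_nonempty hL φ) fun b hb => ?_))
      · rcases hedge with ⟨h0, h1, h2⟩ | ⟨j, hj, h0, h1, h2, h3⟩
        · refine ⟨(z + 1 / 2, extHeight hL φ z), (mem_contour_iff hL φ _).2
            (.inl ⟨z, h0, h1, rfl, by simp, by norm_num⟩), ?_⟩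
          rcases h2 with h2 | h2 <;> rw [h2] <;> simp only [ptR] <;> push_cast <;> ring_nf <;>
            linarith
        · have h2' : (lineLo hL φ j : ℝ) ≤ y := by exact_mod_cast h2
          have h3' : (y : ℝ) + 1 ≤ lineHi hL φ j := by exact_mod_cast h3
          refine ⟨(j, y + 1 / 2), (mem_contour_iff hL φ _).2
            (.inr ⟨j, h0, h1, rfl, by dsimp only; linarith, by dsimp only; linarith⟩), ?_⟩
          rcases hj with rfl | rfl <;> simp only [ptR] <;> push_cast <;> ring_nf <;> linarith
      · simp only [ptR]
        rcases (mem_contour_iff hL φ b).1 hb with ⟨i, _, _, h, _⟩ | ⟨i, _, _, h, _⟩ <;> rw [h]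
        · nlinarith [quarter_le_sq_half_sub_int y (extHeight hL φ i)]
        · nlinarith [quarter_le_sq_half_sub_int z i]
    · push Not at hedge
      obtain ⟨hH, hV⟩ := hedge
      refine Or.inr (hroot ▸ le_antisymm (distToSet_le_sqrt fun δ hδ hδ1 => ?_)
        (sqrt_le_distToSet (contour_nonempty hL φ) fun b hb => ?_))
      · by_cases hk : 1 ≤ k ∧ k < L
        · have hle : lineLo hL φ k ≤ lineHi hL φ k := by unfold lineLo lineHi; omega
          have hle' : (lineLo hL φ k : ℝ) ≤ lineHi hL φ k := by exact_mod_cast hle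
          have key : ∀ m : ℤ, (m = y ∨ m = y + 1) →
              ((z : ℝ) + 1 / 2 - k) ^ 2 + ((y : ℝ) + 1 / 2 - m) ^ 2 ≤ 1 / 2 + 2 * δ := by
            rintro m (rfl | rfl) <;> rcases hkz with rfl | rfl <;> push_cast <;> ring_nf <;>
              linarith
          have := hV k hkz hk.1 hk.2
          rcases le_or_gt (lineLo hL φ k) y with h | h
          · exact ⟨(k, lineHi hL φ k), (mem_contour_iff hL φ _).2
              (.inr ⟨k, hk.1, hk.2, rfl, hle', le_rfl⟩), key _ (by have := this h; omega)⟩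
          · exact ⟨(k, lineLo hL φ k), (mem_contour_iff hL φ _).2
              (.inr ⟨k, hk.1, hk.2, rfl, le_rfl, hle'⟩), key _ (by omega)⟩
        · rcases (by omega : k = 0 ∨ k = L) with rfl | rfl
          · have e : extHeight hL φ (0 - 1) = extHeight hL φ 0 := rfl
            rw [lineLo, e, min_self] at hlo
            rw [lineHi, e, max_self] at hhi
            rcases hkz with rfl | hkz
            · have := hH le_rfl (by omega)
              omega
            · obtain rfl : z = -1 := by omega
              refine ⟨(δ, extHeight hL φ 0), (mem_contour_iff hL φ _).2
                (.inl ⟨0, le_rfl, by omega, rfl, by simpa using hδ, by simpa using hδ1⟩), ?_⟩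
              rcases (by omega : extHeight hL φ 0 = y ∨ extHeight hL φ 0 = y + 1) with h | h <;>
                rw [h] <;> simp only [ptR] <;> push_cast <;> nlinarith
          · have e : extHeight hL φ (L : ℤ) = extHeight hL φ (L - 1) := by
              unfold extHeight
              congr 2
              omega
            rw [lineLo, e, min_self] at hlo
            rw [lineHi, e, max_self] at hhi
            rcases hkz with hkz | hkz
            · refine ⟨(L - δ, extHeight hL φ (L - 1)), (mem_contour_iff hL φ _).2
                (.inl ⟨L - 1, by omega, by omega, rfl, ?_, ?_⟩), ?_⟩
              · push_cast; linarith
              · push_cast; linarith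
              subst hkz
              rcases (by omega : extHeight hL φ (L - 1) = y ∨ extHeight hL φ (L - 1) = y + 1)
                with h | h <;> rw [h] <;> simp only [ptR] <;> push_cast <;> nlinarith
            · obtain rfl : z = L - 1 := by omega
              have := hH (by omega) (by omega)
              omega
      · simp only [ptR]
        rcases (mem_contour_iff hL φ b).1 hb with ⟨i, h0, h1, h, h2, h3⟩ | ⟨i, h0, h1, h, h2, h3⟩ <;>
          rw [h]
        · by_cases hm : extHeight hL φ i = y ∨ extHeight hL φ i = y + 1
          · have hiz : i ≠ z := by
              rintro rfl
              have := hH h0 h1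
              omega
            have hsq : (1 / 4 : ℝ) ≤ ((z : ℝ) + 1 / 2 - b.1) ^ 2 := by
              rcases lt_or_gt_of_ne hiz with hlt | hlt
              · have : (i : ℝ) + 1 ≤ z := by exact_mod_cast hlt
                nlinarith
              · have : (z : ℝ) + 1 ≤ i := by exact_mod_cast hlt
                nlinarith
            linarith [quarter_le_sq_half_sub_int y (extHeight hL φ i)]
          · push Not at hm
            nlinarith [half_le_sq_half_sub_int hm.1 hm.2]
        · by_cases hi : i = z ∨ i = z + 1
          · have hsq : (1 / 4 : ℝ) ≤ ((y : ℝ) + 1 / 2 - b.2) ^ 2 := by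
              rcases lt_or_ge y (lineLo hL φ i) with hlt | hge
              · have : (y : ℝ) + 1 ≤ lineLo hL φ i := by exact_mod_cast hlt
                nlinarith
              · have : (lineHi hL φ i : ℝ) ≤ y := by exact_mod_cast hV i hi h0 h1 hge
                nlinarith
            linarith [quarter_le_sq_half_sub_int z i]
          · push Not at hi
            nlinarith [half_le_sq_half_sub_int hi.1 hi.2]

/-- Step 4: on every vertical dual line `r(z)`, `z ∈ 1/2 + ℤ`,
the set `Δ(φ)` has at most two `+`unstable and at most two `−`unstable points.
A dual site `p = (z, y) ∈ (ℤ²)*` is encoded by integers, `z ∈ ℤ` standing for the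
line `x = z + 1/2`. -/
theorem unstable_points_bound (L : ℕ) (hL : 2 ≤ L) (φ : Cfg L) (z : ℤ) :
    (∃ a b : ℤ × ℤ, {p : ℤ × ℤ | p ∈ Iplus (Delta L φ) ∧ p.1 = z} ⊆ {a, b}) ∧
    (∃ a b : ℤ × ℤ, {p : ℤ × ℤ | p ∈ Iminus (Delta L φ) ∧ p.1 = z} ⊆ {a, b}) := by
  have hL' : 0 < L := by omega
  refine ⟨⟨(z, lineLo hL' φ z - 1), (z, lineLo hL' φ (z + 1) - 1), ?_⟩,
    ⟨(z, lineHi hL' φ z), (z, lineHi hL' φ (z + 1)), ?_⟩⟩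
  all_goals
    rintro ⟨x, y⟩ ⟨⟨hp, hq⟩, rfl⟩
    rw [mem_Delta_iff hL'] at hp hq
    obtain ⟨k, hk, h0, h1, h2, h3⟩ := hp
    simp only at hk h2 h3 hq
    simp only [Set.mem_insert_iff, Set.mem_singleton_iff, Prod.mk.injEq, true_and]
    have : ¬ (_ ∧ _) := fun h => hq ⟨k, hk, h0, h1, h⟩
    rcases hk with rfl | rfl <;> omega
end

section
/- For every β > β̄₀ (large enough that ν̄_L is well defined), every integer L ≥ 2, every i = 2,…,L, and every f ∈ L²(ν̄_L), the following identity holds pointwise: (δ_i^+ f_i)(η) = Ē_L(δ_i^+ f | η_{α_i}) + Σ_{j=1}^{i−1} Ē_L(f_j^+, V_{i,j} | η_{α_i}), where f_j = Ē_L(f | η_{α_j}), f_j^+(η) = f_j(η + δ_i), V_{i,j}(η) = ν̄_L(η_j | η_{α_{j+1}} + δ_i)/ν̄_L(η_j | η_{α_{j+1}}) − 1, and Ē_L(g,h | η_{α_i}) denotes conditional covariance given η_{α_i}. -/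
open scoped BigOperators

/-! ### Sums over cylinder sets -/

/-- The configurations that agree with `η` on `S`. -/
def cylinder {L : ℕ} (S : Set (Fin L)) (η : Cfg L) : Set (Cfg L) := {ζ | ∀ i ∈ S, ζ i = η i}

/-- The sum of `h` over the configurations that agree with `η` on `S`. -/
noncomputable def cylSum {L : ℕ} (S : Set (Fin L)) (h : Cfg L → ℝ) (η : Cfg L) : ℝ :=
  ∑' ζ, (cylinder S η).indicator h ζ

theorem mem_cylinder_comm {L : ℕ} {S : Set (Fin L)} {ζ ξ : Cfg L} :
    ζ ∈ cylinder S ξ ↔ ξ ∈ cylinder S ζ :=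
  ⟨fun h i hi => (h i hi).symm, fun h i hi => (h i hi).symm⟩

theorem cylinder_eq_of_mem {L : ℕ} {S T : Set (Fin L)} (hST : S ⊆ T) {ζ ξ : Cfg L}
    (h : ζ ∈ cylinder T ξ) : cylinder S ζ = cylinder S ξ := by
  ext x
  exact forall₂_congr fun i hi => by rw [h i (hST hi)]

theorem condExp_eq_cylSum {L : ℕ} (w : Cfg L → ℝ) (S : Set (Fin L)) (f : Cfg L → ℝ)
    (η : Cfg L) :
    condExp w S f η = cylSum S (fun ζ => w ζ * f ζ) η / cylSum S w η := by
  unfold condExp cylSum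
  rw [← tsum_subtype, ← tsum_subtype]
  rfl

theorem cylSum_congr {L : ℕ} {S T : Set (Fin L)} (hST : S ⊆ T) (h : Cfg L → ℝ) {ζ ξ : Cfg L}
    (hm : ζ ∈ cylinder T ξ) : cylSum S h ζ = cylSum S h ξ := by
  rw [cylSum, cylSum, cylinder_eq_of_mem hST hm]

theorem cylSum_pos {L : ℕ} (S : Set (Fin L)) {a : Cfg L → ℝ} (ha : ∀ ζ, 0 < a ζ)
    (hs : Summable a) (η : Cfg L) : 0 < cylSum S a η := by
  refine (hs.indicator _).tsum_pos (fun ζ => Set.indicator_nonneg (fun x _ => (ha x).le) ζ) η ?_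
  rw [Set.indicator_of_mem (show η ∈ cylinder S η from fun _ _ => rfl)]
  exact ha η

theorem cylSum_mono {L : ℕ} (S : Set (Fin L)) {a b : Cfg L → ℝ} (hab : ∀ ζ, a ζ ≤ b ζ)
    (ha : Summable a) (hb : Summable b) (η : Cfg L) : cylSum S a η ≤ cylSum S b η :=
  (ha.indicator _).tsum_le_tsum (fun ζ => Set.indicator_le_indicator (hab ζ)) (hb.indicator _)

theorem cylSum_const_mul {L : ℕ} (S : Set (Fin L)) (C : ℝ) (a : Cfg L → ℝ) (η : Cfg L) :
    cylSum S (fun ζ => C * a ζ) η = C * cylSum S a η := by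
  unfold cylSum
  rw [← tsum_mul_left]
  congr 1; ext ζ
  by_cases h : ζ ∈ cylinder S η <;> simp [h]

theorem cylSum_univ {L : ℕ} {S : Set (Fin L)} (hS : ∀ i, i ∈ S) (h : Cfg L → ℝ) (η : Cfg L) :
    cylSum S h η = h η := by
  have : cylinder S η = {η} := by
    ext x
    exact ⟨fun hx => funext fun i => hx i (hS i), fun hx i _ => by rw [hx]⟩
  rw [cylSum, this, tsum_eq_single η]
  · simp
  · intro b hb; simp [hb]

/-- Summation against a `T`-measurable density exchanges a function with its sum
over `T`-cylinders. -/
theorem cylSum_exchange {L : ℕ} (T : Set (Fin L)) {a K h : Cfg L → ℝ} (ha : ∀ ζ, 0 ≤ a ζ)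
    (hs : Summable a) (hK0 : ∀ ζ, 0 ≤ K ζ) (hK : ∀ ζ ξ, ζ ∈ cylinder T ξ → K ζ = K ξ)
    (hh : Summable fun ξ => |h ξ| * K ξ * cylSum T a ξ) :
    Summable (fun ζ => a ζ * K ζ * cylSum T h ζ) ∧
      ∑' ζ, a ζ * K ζ * cylSum T h ζ = ∑' ξ, h ξ * K ξ * cylSum T a ξ := by
  have hG : Summable fun q : Cfg L × Cfg L => h q.1 * K q.1 * (cylinder T q.1).indicator a q.2 := by
    apply Summable.of_norm
    have hn : ∀ ξ ζ : Cfg L, ‖h ξ * K ξ * (cylinder T ξ).indicator a ζ‖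
        = |h ξ| * K ξ * (cylinder T ξ).indicator a ζ := by
      intro ξ ζ
      rw [norm_mul, norm_mul, Real.norm_eq_abs, Real.norm_of_nonneg (hK0 _),
        Real.norm_of_nonneg (Set.indicator_nonneg (fun x _ => ha x) _)]
    rw [summable_prod_of_nonneg (fun q => norm_nonneg _)]
    constructor
    · intro ξ
      simp only [hn]
      exact (hs.indicator _).mul_left _
    · simp only [hn, tsum_mul_left]
      exact hh
  have hF : Summable fun q : Cfg L × Cfg L =>
      h q.2 * K q.2 * (cylinder T q.2).indicator a q.1 :=
    (Equiv.prodComm (Cfg L) (Cfg L)).summable_iff.2 hG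
  have hFeq : ∀ ζ ξ : Cfg L, h ξ * K ξ * (cylinder T ξ).indicator a ζ
      = a ζ * K ζ * (cylinder T ζ).indicator h ξ := by
    intro ζ ξ
    by_cases hm : ζ ∈ cylinder T ξ
    · rw [Set.indicator_of_mem hm, Set.indicator_of_mem (mem_cylinder_comm.1 hm), hK ζ ξ hm]
      ring
    · rw [Set.indicator_of_notMem hm,
        Set.indicator_of_notMem (fun h' => hm (mem_cylinder_comm.1 h'))]
      ring
  have hin : ∀ ζ, ∑' ξ, h ξ * K ξ * (cylinder T ξ).indicator a ζ
      = a ζ * K ζ * cylSum T h ζ := by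
    intro ζ
    simp only [hFeq, tsum_mul_left]
    rfl
  constructor
  · have := hF.prod
    simpa only [hin] using this
  · have hcomm := Summable.tsum_comm
      (f := fun ξ ζ : Cfg L => h ξ * K ξ * (cylinder T ξ).indicator a ζ) hG
    rw [← tsum_congr hin, hcomm]
    simp only [tsum_mul_left]
    rfl

/-- Write `A_S`, `B_S` for the sums of `a`, `b` over `S`-cylinders. On a `U`-cylinder, the
`T`-conditional expectation of `g` under `b`, tilted by `(B_T / B_S) / (A_T / A_S)` and summed
against `a`, has the same total as `b g A_S / B_S`. -/
theorem tilted_cylSum {L : ℕ} {S T U : Set (Fin L)} (hST : S ⊆ T) (hUT : U ⊆ T)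
    {a b g : Cfg L → ℝ} {C : ℝ}
    (ha : ∀ ζ, 0 < a ζ) (hb : ∀ ζ, 0 < b ζ) (hsa : Summable a) (hsb : Summable b)
    (hC : 0 ≤ C) (hab : ∀ ζ, a ζ ≤ C * b ζ) (hg : Summable fun ζ => b ζ * |g ζ|) (η : Cfg L) :
    Summable (fun ζ => (cylinder U η).indicator (fun ζ => a ζ *
        (cylSum T (fun x => b x * g x) ζ / cylSum T b ζ *
          ((cylSum T b ζ / cylSum S b ζ) / (cylSum T a ζ / cylSum S a ζ)))) ζ) ∧
      cylSum U (fun ζ => a ζ *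
        (cylSum T (fun x => b x * g x) ζ / cylSum T b ζ *
          ((cylSum T b ζ / cylSum S b ζ) / (cylSum T a ζ / cylSum S a ζ)))) η
      = cylSum U (fun ξ => b ξ * g ξ * (cylSum S a ξ / cylSum S b ξ)) η := by
  have hA := fun ζ => cylSum_pos S ha hsa ζ
  have hB := fun ζ => cylSum_pos S hb hsb ζ
  have hA' := fun ζ => cylSum_pos T ha hsa ζ
  have hB' := fun ζ => cylSum_pos T hb hsb ζ
  set K : Cfg L → ℝ := (cylinder U η).indicator fun ζ =>
    cylSum S a ζ / (cylSum S b ζ * cylSum T a ζ) with hKdef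
  have hK0 : ∀ ζ, 0 ≤ K ζ := fun ζ => Set.indicator_nonneg
    (fun x _ => (div_pos (hA x) (mul_pos (hB x) (hA' x))).le) ζ
  have hK : ∀ ζ ξ, ζ ∈ cylinder T ξ → K ζ = K ξ := by
    intro ζ ξ hm
    have hU : ζ ∈ cylinder U η ↔ ξ ∈ cylinder U η := by
      rw [mem_cylinder_comm, cylinder_eq_of_mem hUT hm, mem_cylinder_comm]
    by_cases h : ξ ∈ cylinder U η
    · rw [hKdef, Set.indicator_of_mem h, Set.indicator_of_mem (hU.2 h),
        cylSum_congr hST _ hm, cylSum_congr hST _ hm, cylSum_congr subset_rfl _ hm]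
    · rw [hKdef, Set.indicator_of_notMem h, Set.indicator_of_notMem (fun h' => h (hU.1 h'))]
  have hratio : ∀ ξ, cylSum S a ξ / cylSum S b ξ ≤ C := by
    intro ξ
    rw [div_le_iff₀ (hB ξ), ← cylSum_const_mul]
    exact cylSum_mono S hab hsa (hsb.mul_left C) ξ
  have hKA : ∀ ξ, K ξ * cylSum T a ξ
      = (cylinder U η).indicator (fun ξ => cylSum S a ξ / cylSum S b ξ) ξ := by
    intro ξ
    by_cases h : ξ ∈ cylinder U η
    · rw [hKdef, Set.indicator_of_mem h, Set.indicator_of_mem h]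
      have := (hA' ξ).ne'
      have := (hB ξ).ne'
      field_simp
    · rw [hKdef, Set.indicator_of_notMem h, Set.indicator_of_notMem h, zero_mul]
  have hh : Summable fun ξ => |b ξ * g ξ| * K ξ * cylSum T a ξ := by
    refine Summable.of_nonneg_of_le
      (fun ξ => mul_nonneg (mul_nonneg (abs_nonneg _) (hK0 ξ)) (hA' ξ).le) (fun ξ => ?_)
      (hg.mul_right C)
    rw [mul_assoc, hKA, abs_mul, abs_of_pos (hb ξ)]
    refine mul_le_mul_of_nonneg_left ?_ (mul_nonneg (hb ξ).le (abs_nonneg _))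
    exact Set.indicator_le' (fun x _ => hratio x) (fun x _ => hC) ξ
  obtain ⟨h1, h2⟩ := cylSum_exchange T (fun ζ => (ha ζ).le) hsa hK0 hK hh
  have e1 : ∀ ζ, a ζ * K ζ * cylSum T (fun x => b x * g x) ζ
      = (cylinder U η).indicator (fun ζ => a ζ *
        (cylSum T (fun x => b x * g x) ζ / cylSum T b ζ *
          ((cylSum T b ζ / cylSum S b ζ) / (cylSum T a ζ / cylSum S a ζ)))) ζ := by
    intro ζ
    by_cases h : ζ ∈ cylinder U η
    · rw [hKdef, Set.indicator_of_mem h, Set.indicator_of_mem h]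
      have := (hA ζ).ne'
      have := (hB ζ).ne'
      have := (hA' ζ).ne'
      have := (hB' ζ).ne'
      field_simp
    · rw [hKdef, Set.indicator_of_notMem h, Set.indicator_of_notMem h]
      ring
  have e2 : ∀ ξ, b ξ * g ξ * K ξ * cylSum T a ξ
      = (cylinder U η).indicator
        (fun ξ => b ξ * g ξ * (cylSum S a ξ / cylSum S b ξ)) ξ := by
    intro ξ
    rw [mul_assoc, hKA]
    by_cases h : ξ ∈ cylinder U η <;> simp [h]
  simp only [e1, e2] at h1 h2
  exact ⟨h1, h2⟩

/-- The sum of `b g A_S / B_S` over the `U`-cylinder of `η`, where `A_S`, `B_S` are the sums of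
`a`, `b` over `S`-cylinders. -/
noncomputable def ratioSum {L : ℕ} (U : Set (Fin L)) (a b g : Cfg L → ℝ) (η : Cfg L)
    (S : Set (Fin L)) : ℝ :=
  cylSum U (fun ξ => b ξ * g ξ * (cylSum S a ξ / cylSum S b ξ)) η

theorem cylSum_mul_condExp {L : ℕ} {T U : Set (Fin L)} (hUT : U ⊆ T)
    {a b g : Cfg L → ℝ} {C : ℝ}
    (ha : ∀ ζ, 0 < a ζ) (hb : ∀ ζ, 0 < b ζ) (hsa : Summable a) (hsb : Summable b)
    (hC : 0 ≤ C) (hab : ∀ ζ, a ζ ≤ C * b ζ) (hg : Summable fun ζ => b ζ * |g ζ|) (η : Cfg L) :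
    Summable (fun ζ => (cylinder U η).indicator (fun ζ => a ζ *
        (cylSum T (fun x => b x * g x) ζ / cylSum T b ζ)) ζ) ∧
      cylSum U (fun ζ => a ζ * (cylSum T (fun x => b x * g x) ζ / cylSum T b ζ)) η
      = ratioSum U a b g η T := by
  have key := tilted_cylSum (S := T) subset_rfl hUT ha hb hsa hsb hC hab hg η
  have h1 : ∀ ζ, (cylSum T b ζ / cylSum T b ζ) / (cylSum T a ζ / cylSum T a ζ) = 1 := by
    intro ζ
    rw [div_self (cylSum_pos T hb hsb ζ).ne', div_self (cylSum_pos T ha hsa ζ).ne', div_one]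
  simp only [h1, mul_one] at key
  exact key

theorem ratioSum_one {L : ℕ} {T U : Set (Fin L)} (hUT : U ⊆ T) {a b : Cfg L → ℝ} {C : ℝ}
    (ha : ∀ ζ, 0 < a ζ) (hb : ∀ ζ, 0 < b ζ) (hsa : Summable a) (hsb : Summable b)
    (hC : 0 ≤ C) (hab : ∀ ζ, a ζ ≤ C * b ζ) (η : Cfg L) :
    ratioSum U a b (fun _ => 1) η T = cylSum U a η := by
  rw [← (cylSum_mul_condExp hUT ha hb hsa hsb hC hab (by simpa using hsb) η).2]
  simp only [mul_one, div_self (cylSum_pos T hb hsb _).ne']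

/-- The covariance with the likelihood ratio of the one-step conditional laws. -/
theorem covariance_ratio {L : ℕ} {S T U : Set (Fin L)} (hUS : U ⊆ S) (hST : S ⊆ T)
    {a b g : Cfg L → ℝ} {C : ℝ}
    (ha : ∀ ζ, 0 < a ζ) (hb : ∀ ζ, 0 < b ζ) (hsa : Summable a) (hsb : Summable b)
    (hC : 0 ≤ C) (hab : ∀ ζ, a ζ ≤ C * b ζ) (hg : Summable fun ζ => b ζ * |g ζ|) (η : Cfg L) :
    condCov a U (fun ζ => cylSum T (fun x => b x * g x) ζ / cylSum T b ζ)
      (fun ζ => (cylSum T b ζ / cylSum S b ζ) / (cylSum T a ζ / cylSum S a ζ) - 1) η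
    = (ratioSum U a b g η S - ratioSum U a b g η T) / cylSum U a η := by
  have hUT := hUS.trans hST
  have one : ∀ ζ, cylSum T (fun x => b x * 1) ζ / cylSum T b ζ = 1 := fun ζ => by
    simp only [mul_one, div_self (cylSum_pos T hb hsb ζ).ne']
  have sub : ∀ F G : Cfg L → ℝ, Summable (fun ζ => (cylinder U η).indicator F ζ) →
      Summable (fun ζ => (cylinder U η).indicator G ζ) →
      cylSum U (fun ζ => F ζ - G ζ) η = cylSum U F η - cylSum U G η := by
    intro F G hF hG
    rw [cylSum, cylSum, cylSum, ← hF.tsum_sub hG]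
    congr 1; ext ζ
    by_cases h : ζ ∈ cylinder U η <;> simp [h]
  have hg1 : Summable fun ζ => b ζ * |(fun _ => (1 : ℝ)) ζ| := by simpa using hsb
  have t1 := tilted_cylSum hST hUT ha hb hsa hsb hC hab hg1 η
  simp only [one, one_mul] at t1
  have t2 := tilted_cylSum hST hUT ha hb hsa hsb hC hab hg η
  have t3 := cylSum_mul_condExp hUT ha hb hsa hsb hC hab hg η
  have hr : cylSum U (fun ξ => b ξ * 1 * (cylSum S a ξ / cylSum S b ξ)) η = cylSum U a η :=
    ratioSum_one hUS ha hb hsa hsb hC hab η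
  have z : condExp a U
      (fun ζ => (cylSum T b ζ / cylSum S b ζ) / (cylSum T a ζ / cylSum S a ζ) - 1) η = 0 := by
    rw [condExp_eq_cylSum]
    simp only [mul_sub, mul_one]
    rw [sub _ _ t1.1 (hsa.indicator _), t1.2, hr, sub_self, zero_div]
  rw [condCov, z, mul_zero, sub_zero, condExp_eq_cylSum]
  simp only [mul_sub, mul_one]
  rw [sub _ _ t2.1 t3.1, t2.2, t3.2]
  rfl

/-! ### Shifting one coordinate -/

theorem upd_apply {L : ℕ} (ζ : Cfg L) (i k : Fin L) :
    upd ζ i 1 k = ζ k + if k = i then 1 else 0 := by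
  unfold upd; split_ifs <;> simp

/-- Raising the coordinate `i` by one, as an equivalence. -/
def shiftEquiv {L : ℕ} (i : Fin L) : Cfg L ≃ Cfg L :=
  Equiv.addRight (fun k => if k = i then 1 else 0)

theorem shiftEquiv_apply {L : ℕ} (i : Fin L) (ζ : Cfg L) : shiftEquiv i ζ = upd ζ i 1 := by
  ext k
  rw [upd_apply]
  rfl

theorem cylSum_upd {L : ℕ} (S : Set (Fin L)) (i : Fin L) (h : Cfg L → ℝ) (ζ : Cfg L) :
    cylSum S h (upd ζ i 1) = cylSum S (fun ξ => h (upd ξ i 1)) ζ := by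
  unfold cylSum
  rw [← (shiftEquiv i).tsum_eq]
  congr 1; ext ξ
  rw [shiftEquiv_apply]
  have : upd ξ i 1 ∈ cylinder S (upd ζ i 1) ↔ ξ ∈ cylinder S ζ :=
    forall₂_congr fun k _ => by rw [upd_apply, upd_apply, add_left_inj]
  by_cases hm : ξ ∈ cylinder S ζ
  · rw [Set.indicator_of_mem hm, Set.indicator_of_mem (this.2 hm)]
  · rw [Set.indicator_of_notMem hm, Set.indicator_of_notMem (fun h' => hm (this.1 h'))]

theorem condProbAbove_eq_cylSum {L : ℕ} (w : Cfg L → ℝ) (j : Fin L) (η : Cfg L) :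
    condProbAbove w j (η j) η = cylSum {l | j ≤ l} w η / cylSum {l | j < l} w η := by
  rw [condProbAbove, condExp_eq_cylSum]
  congr 1
  unfold cylSum
  congr 1; ext ξ
  have : ξ ∈ cylinder {l | j ≤ l} η ↔ ξ ∈ cylinder {l | j < l} η ∧ ξ j = η j := by
    constructor
    · exact fun h => ⟨fun l hl => h l (le_of_lt (show j < l from hl)), h j (le_refl j)⟩
    · rintro ⟨h1, h2⟩ l hl
      rcases eq_or_lt_of_le (show j ≤ l from hl) with h | h
      · rw [← h, h2]
      · exact h1 l h
  by_cases h1 : ξ ∈ cylinder {l | j < l} η <;> by_cases h2 : ξ j = η j <;>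
    simp [h1, h2, this]

/-- The martingale decomposition for a positive summable weight that decreases at most by a
constant factor when coordinate `i` is raised by one. -/
theorem martingale_identity_of_weight {L : ℕ} {w : Cfg L → ℝ} (hw : ∀ ζ, 0 < w ζ)
    (hsum : Summable w) {i : Fin L} {C : ℝ} (hC : 0 ≤ C)
    (hwC : ∀ ζ, w ζ ≤ C * w (upd ζ i 1)) {f : Cfg L → ℝ}
    (hf : Summable fun ζ => w ζ * |f ζ|) (η : Cfg L) :
    condExp w {l : Fin L | i ≤ l} f (upd η i 1) - condExp w {l : Fin L | i ≤ l} f η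
    = condExp w {l : Fin L | i ≤ l} (fun ζ => f (upd ζ i 1) - f ζ) η
      + ∑ j : Fin L, (if j < i then
          condCov w {l : Fin L | i ≤ l}
            (fun ζ => condExp w {l : Fin L | j ≤ l} f (upd ζ i 1))
            (fun ζ => condProbAbove w j (ζ j) (upd ζ i 1) / condProbAbove w j (ζ j) ζ - 1) η
        else 0) := by
  set b : Cfg L → ℝ := fun ζ => w (upd ζ i 1)
  set g : Cfg L → ℝ := fun ζ => f (upd ζ i 1)
  set U : Set (Fin L) := {l | i ≤ l}
  have hb : ∀ ζ, 0 < b ζ := fun ζ => hw _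
  have hsb : Summable b := by
    simpa only [Function.comp_def, shiftEquiv_apply] using
      hsum.comp_injective (shiftEquiv i).injective
  have hg : Summable fun ζ => b ζ * |g ζ| := by
    simpa only [Function.comp_def, shiftEquiv_apply] using
      hf.comp_injective (shiftEquiv i).injective
  have hA := cylSum_pos U hw hsum η
  have hB := cylSum_pos U hb hsb η
  set r : ℕ → ℝ := fun n => ratioSum U w b g η {l | n ≤ (l : ℕ)} with hr
  have hterm : ∀ j : Fin L, (if j < i then
          condCov w U (fun ζ => condExp w {l : Fin L | j ≤ l} f (upd ζ i 1))
            (fun ζ => condProbAbove w j (ζ j) (upd ζ i 1) / condProbAbove w j (ζ j) ζ - 1) η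
        else 0) = if (j : ℕ) < i then (r (j + 1) - r j) / cylSum U w η else 0 := by
    intro j
    by_cases hj : j < i
    · rw [if_pos hj, if_pos (Fin.lt_def.1 hj)]
      have hUS : U ⊆ {l | j < l} := fun l hl => lt_of_lt_of_le hj (show i ≤ l from hl)
      have hST : {l : Fin L | j < l} ⊆ {l | j ≤ l} := fun l hl => le_of_lt (show j < l from hl)
      have cov := covariance_ratio hUS hST hw hb hsum hsb hC hwC hg η
      have e1 : ∀ ζ, condExp w {l : Fin L | j ≤ l} f (upd ζ i 1)
          = cylSum {l | j ≤ l} (fun x => b x * g x) ζ / cylSum {l | j ≤ l} b ζ := by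
        intro ζ
        rw [condExp_eq_cylSum, cylSum_upd, cylSum_upd]
      have e2 : ∀ ζ, condProbAbove w j (ζ j) (upd ζ i 1)
          = cylSum {l | j ≤ l} b ζ / cylSum {l | j < l} b ζ := by
        intro ζ
        have : ζ j = upd ζ i 1 j := by rw [upd_apply, if_neg hj.ne, add_zero]
        rw [this, condProbAbove_eq_cylSum, cylSum_upd, cylSum_upd]
      simp only [e1, e2, condProbAbove_eq_cylSum]
      rw [cov]
      rfl
    · rw [if_neg hj, if_neg (fun h => hj (Fin.lt_def.2 h))]
  have hsumr : ∑ j : Fin L, (if (j : ℕ) < i then (r (j + 1) - r j) / cylSum U w η else 0)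
      = (r i - r 0) / cylSum U w η := by
    rw [Fin.sum_univ_eq_sum_range
      (fun n => if n < (i : ℕ) then (r (n + 1) - r n) / cylSum U w η else 0) L,
      ← Finset.sum_filter]
    have : (Finset.range L).filter (fun n => n < (i : ℕ)) = Finset.range i := by
      ext n
      simp only [Finset.mem_filter, Finset.mem_range]
      have := i.isLt
      omega
    rw [this, ← Finset.sum_div, Finset.sum_range_sub]
  have hri : r i / cylSum U w η = condExp w U f (upd η i 1) := by
    rw [condExp_eq_cylSum, cylSum_upd, cylSum_upd]
    have : r i = cylSum U (fun x => b x * g x) η * (cylSum U w η / cylSum U b η) := by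
      change ratioSum U w b g η U = _
      rw [ratioSum, cylSum, cylSum, ← tsum_mul_right]
      congr 1; ext ξ
      by_cases h : ξ ∈ cylinder U η
      · rw [Set.indicator_of_mem h, Set.indicator_of_mem h, cylSum_congr subset_rfl w h,
          cylSum_congr subset_rfl b h]
      · rw [Set.indicator_of_notMem h, Set.indicator_of_notMem h, zero_mul]
    change r i / cylSum U w η = cylSum U (fun x => b x * g x) η / cylSum U b η
    rw [this]
    field_simp
  have hwg : Summable fun ζ => w ζ * g ζ := by
    refine Summable.of_norm_bounded (hg.mul_left C) fun ζ => ?_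
    rw [norm_mul, Real.norm_of_nonneg (hw ζ).le, Real.norm_eq_abs, ← mul_assoc]
    exact mul_le_mul_of_nonneg_right (hwC ζ) (abs_nonneg _)
  have hwf : Summable fun ζ => w ζ * f ζ := by
    refine Summable.of_norm_bounded hf fun ζ => ?_
    rw [norm_mul, Real.norm_of_nonneg (hw ζ).le, Real.norm_eq_abs]
  have hr0 : r 0 = cylSum U (fun ζ => w ζ * g ζ) η := by
    simp only [hr, ratioSum]
    congr 1; ext ξ
    rw [cylSum_univ (by simp), cylSum_univ (by simp)]
    have := (hb ξ).ne'
    field_simp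
  have hdiff : condExp w U (fun ζ => g ζ - f ζ) η
      = r 0 / cylSum U w η - condExp w U f η := by
    rw [condExp_eq_cylSum, condExp_eq_cylSum, hr0, ← sub_div]
    congr 1
    rw [cylSum, cylSum, cylSum, ← (hwg.indicator _).tsum_sub (hwf.indicator _)]
    congr 1; ext ζ
    by_cases h : ζ ∈ cylinder U η <;> simp [h, mul_sub]
  rw [Finset.sum_congr rfl (fun j _ => hterm j), hsumr, hdiff, ← hri]
  ring

/-! ### Locality of the contour and the interaction -/

theorem abs_snd_sub_le_rdist (p a : ℝ × ℝ) : |p.2 - a.2| ≤ rdist p a :=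
  Real.abs_le_sqrt (by nlinarith [sq_nonneg (p.1 - a.1)])

/-- Distances smaller than one only depend on the part of the set in the unit ball. -/
theorem distToSet_eq_of_local {p : ℝ × ℝ} {S S' : Set (ℝ × ℝ)}
    (h : ∀ a, rdist p a < 1 → (a ∈ S ↔ a ∈ S')) {d : ℝ} (h0 : 0 < d) (h1 : d < 1)
    (hd : distToSet p S = d) : distToSet p S' = d := by
  have hne : (rdist p '' S).Nonempty := by
    by_contra hcon
    rw [Set.not_nonempty_iff_eq_empty] at hcon
    rw [distToSet, hcon, Real.sInf_empty] at hd
    exact h0.ne hd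
  have bdd : ∀ A : Set (ℝ × ℝ), BddBelow (rdist p '' A) := fun A =>
    ⟨0, by rintro _ ⟨a, _, rfl⟩; exact Real.sqrt_nonneg _⟩
  have near : ∀ c, d < c → ∃ a ∈ S', rdist p a < c := by
    intro c hc
    obtain ⟨_, ⟨a, ha, rfl⟩, hac⟩ := exists_lt_of_csInf_lt hne
      (show sInf (rdist p '' S) < min c 1 from lt_min (hd.trans_lt hc) (hd.trans_lt h1))
    exact ⟨a, (h a (hac.trans_le (min_le_right _ _))).1 ha, hac.trans_le (min_le_left _ _)⟩
  refine csInf_eq_of_forall_ge_of_forall_gt_exists_lt ?_ ?_ ?_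
  · obtain ⟨a, ha, _⟩ := near 1 h1
    exact ⟨_, a, ha, rfl⟩
  · rintro _ ⟨a, ha, rfl⟩
    by_cases hlt : rdist p a < 1
    · rw [← hd]
      exact csInf_le (bdd S) ⟨a, (h a hlt).2 ha, rfl⟩
    · linarith
  · intro c hc
    obtain ⟨a, ha, hac⟩ := near c hc
    exact ⟨_, ⟨a, ha, rfl⟩, hac⟩

/-- Away from all heights, raising some of the heights by one does not change the contour. -/
theorem mem_contour_congr {N : ℕ} {φ φ' : Cfg N} (hφ : ∀ j, φ' j = φ j ∨ φ' j = φ j + 1)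
    {a : ℝ × ℝ} (ha : ∀ j, a.2 < φ j ∨ (φ j : ℝ) + 1 < a.2) :
    a ∈ contour N φ ↔ a ∈ contour N φ' := by
  have hR : ∀ j, (φ' j : ℝ) = φ j ∨ (φ' j : ℝ) = φ j + 1 := fun j => by
    rcases hφ j with h | h
    · left; rw [h]
    · right; rw [h]; push_cast; ring
  have hle : ∀ j, ((φ j : ℝ) ≤ a.2 ↔ (φ' j : ℝ) ≤ a.2) := fun j => by
    rcases hR j with h | h <;> rcases ha j with h' | h' <;> constructor <;> intro <;> linarith
  have hge : ∀ j, (a.2 ≤ (φ j : ℝ) ↔ a.2 ≤ (φ' j : ℝ)) := fun j => by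
    rcases hR j with h | h <;> rcases ha j with h' | h' <;> constructor <;> intro <;> linarith
  have heq : ∀ j, (a.2 = (φ j : ℝ) ↔ a.2 = (φ' j : ℝ)) := fun j => by
    rw [le_antisymm_iff, le_antisymm_iff, hle, hge]
  simp only [contour, Set.mem_ofPred_eq, min_le_iff, le_max_iff, hle, hge, heq]

theorem mem_Delta_congr {N : ℕ} {φ φ' : Cfg N} (hφ : ∀ j, φ' j = φ j ∨ φ' j = φ j + 1)
    {p : ℤ × ℤ} (hp : ∀ j, p.2 < φ j - 3 ∨ φ j + 3 < p.2) :
    p ∈ Delta N φ ↔ p ∈ Delta N φ' := by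
  have loc : ∀ a, rdist (ptR p) a < 1 → (a ∈ contour N φ ↔ a ∈ contour N φ') := by
    intro a ha
    refine mem_contour_congr hφ fun j => ?_
    have hlt := abs_lt.1 ((abs_snd_sub_le_rdist (ptR p) a).trans_lt ha)
    simp only [ptR] at hlt
    rcases hp j with h | h
    · left
      have : (p.2 : ℝ) < φ j - 3 := by exact_mod_cast h
      linarith
    · right
      have : (φ j : ℝ) + 3 < p.2 := by exact_mod_cast h
      linarith
  have hs : (1 : ℝ) < Real.sqrt 2 := by
    rw [Real.lt_sqrt zero_le_one]; norm_num
  have hs0 : 0 < 1 / Real.sqrt 2 := by positivity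
  have hs1 : 1 / Real.sqrt 2 < 1 := (div_lt_one (by positivity)).2 hs
  have key : ∀ d : ℝ, 0 < d → d < 1 → (distToSet (ptR p) (contour N φ) = d ↔
      distToSet (ptR p) (contour N φ') = d) := fun d h0 h1 =>
    ⟨distToSet_eq_of_local loc h0 h1, distToSet_eq_of_local (fun a ha => (loc a ha).symm) h0 h1⟩
  simp only [Delta, Set.mem_ofPred_eq, key _ hs0 hs1,
    key (1 / 2) (by norm_num) (by norm_num)]

theorem IsConn.translate {Λ : Finset (ℤ × ℤ)} (h : IsConn Λ) (v : ℤ × ℤ) :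
    IsConn (Λ.image (· + v)) := by
  refine ⟨h.1.image _, fun p hp q hq => ?_⟩
  obtain ⟨p', hp', rfl⟩ := Finset.mem_image.1 hp
  obtain ⟨q', hq', rfl⟩ := Finset.mem_image.1 hq
  refine Relation.ReflTransGen.lift (· + v) ?_ _ _ (h.2 p' hp' q' hq')
  rintro a c ⟨ha, hc, hac⟩
  refine ⟨Finset.mem_image_of_mem _ ha, Finset.mem_image_of_mem _ hc, ?_⟩
  simpa [dualAdj] using hac

/-- The absolute value of the potential, restricted to connected sets containing `p`. -/
noncomputable def Potential.absAt (P : Potential) (β : ℝ) (p : ℤ × ℤ) :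
    Finset (ℤ × ℤ) → ℝ :=
  {Λ | IsConn Λ ∧ p ∈ Λ}.indicator fun Λ => |P.Φ β Λ|

theorem Potential.absAt_nonneg (P : Potential) (β : ℝ) (p : ℤ × ℤ) (Λ : Finset (ℤ × ℤ)) :
    0 ≤ P.absAt β p Λ :=
  Set.indicator_nonneg (fun _ _ => abs_nonneg _) Λ

theorem Potential.summable_absAt (P : Potential) {β : ℝ} (hβ : P.β₀ < β) (p : ℤ × ℤ) :
    Summable (P.absAt β p) :=
  summable_subtype_iff_indicator.1 (P.abs_summable β hβ p)

theorem Potential.tsum_absAt_le (P : Potential) {β : ℝ} (hβ : P.β₀ < β) (p : ℤ × ℤ) :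
    ∑' Λ, P.absAt β p Λ ≤ ∑' Λ, P.absAt β 0 Λ := by
  have hinj : Function.Injective fun Λ : Finset (ℤ × ℤ) => Λ.image (· + (-p)) :=
    Finset.image_injective (add_left_injective _)
  refine Summable.tsum_le_tsum_of_inj _ hinj (fun c _ => P.absAt_nonneg β 0 c) (fun Λ => ?_)
    (P.summable_absAt hβ p) (P.summable_absAt hβ 0)
  by_cases h : IsConn Λ ∧ p ∈ Λ
  · have h' : IsConn (Λ.image (· + (-p))) ∧ (0 : ℤ × ℤ) ∈ Λ.image (· + (-p)) :=
      ⟨h.1.translate _, Finset.mem_image.2 ⟨p, h.2, add_neg_cancel p⟩⟩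
    rw [absAt, absAt, Set.indicator_of_mem (by exact h), Set.indicator_of_mem (by exact h'),
      P.trans_inv]
  · rw [absAt, Set.indicator_of_notMem (by exact h)]
    exact P.absAt_nonneg β 0 _

/-- The interaction changes by a bounded amount when some heights are raised by one. -/
theorem exists_abs_WInf_sub_le (P : Potential) {β : ℝ} (hβ : P.β₀ < β) (N : ℕ) :
    ∃ C : ℝ, ∀ φ φ' : Cfg N, (∀ j, φ' j = φ j ∨ φ' j = φ j + 1) →
      |WInf P β N φ' - WInf P β N φ| ≤ C := by
  set I : Finset (ℤ × Fin N × ℤ) := Finset.Icc (-1) (N : ℤ) ×ˢ Finset.univ ×ˢ Finset.Icc (-3) 3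
  refine ⟨∑ _q ∈ I, ∑' Λ, P.absAt β 0 Λ, fun φ φ' hφ => ?_⟩
  set A : Cfg N → Set (Finset (ℤ × ℤ)) := fun φ =>
    {Λ | IsConn Λ ∧ ↑Λ ⊆ VInf N ∧ ∃ p ∈ Λ, p ∈ Delta N φ}
  have hW : ∀ φ, WInf P β N φ = ∑' Λ, (A φ).indicator (P.Φ β) Λ := fun φ => by
    rw [← tsum_subtype]; rfl
  set pt : ℤ × Fin N × ℤ → ℤ × ℤ := fun q => (q.1, φ q.2.1 + q.2.2)
  set D : Finset (ℤ × ℤ) → ℝ := fun Λ =>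
    (A φ').indicator (P.Φ β) Λ - (A φ).indicator (P.Φ β) Λ with hD
  have hsumm : Summable fun Λ => ∑ q ∈ I, P.absAt β (pt q) Λ :=
    summable_sum fun q _ => P.summable_absAt hβ (pt q)
  have main : ∀ Λ p, IsConn Λ → ↑Λ ⊆ VInf N → p ∈ Λ → ¬ (p ∈ Delta N φ ↔ p ∈ Delta N φ') →
      |P.Φ β Λ| ≤ ∑ q ∈ I, P.absAt β (pt q) Λ := by
    intro Λ p hc hV hp hne
    have : ∃ j, φ j - 3 ≤ p.2 ∧ p.2 ≤ φ j + 3 := by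
      by_contra! hcon
      refine hne (mem_Delta_congr hφ fun j => ?_)
      by_cases h : φ j - 3 ≤ p.2
      · exact Or.inr (hcon j h)
      · exact Or.inl (not_le.1 h)
    obtain ⟨j, hj1, hj2⟩ := this
    obtain ⟨hv1, hv2⟩ := hV hp
    simp only [ptR] at hv1 hv2
    have c1 : (-1 : ℤ) ≤ p.1 := by
      have : ((-1 : ℤ) : ℝ) ≤ p.1 := by push_cast; linarith
      exact_mod_cast this
    have c2 : p.1 ≤ (N : ℤ) := by
      have : (p.1 : ℝ) ≤ ((N : ℤ) : ℝ) := by push_cast; linarith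
      exact_mod_cast this
    have hq : (p.1, j, p.2 - φ j) ∈ I := by
      simp only [I, Finset.mem_product, Finset.mem_Icc, Finset.mem_univ, true_and]
      refine ⟨⟨c1, c2⟩, ?_, ?_⟩ <;> omega
    have hpt : pt (p.1, j, p.2 - φ j) = p := by
      ext <;> simp [pt]
    have : |P.Φ β Λ| = P.absAt β (pt (p.1, j, p.2 - φ j)) Λ := by
      rw [hpt, Potential.absAt, Set.indicator_of_mem]
      exact ⟨hc, hp⟩
    rw [this]
    exact Finset.single_le_sum (f := fun q => P.absAt β (pt q) Λ)
      (fun q _ => P.absAt_nonneg β (pt q) Λ) hq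
  have hbound : ∀ Λ, ‖D Λ‖ ≤ ∑ q ∈ I, P.absAt β (pt q) Λ := by
    intro Λ
    rw [Real.norm_eq_abs]
    by_cases h : Λ ∈ A φ <;> by_cases h' : Λ ∈ A φ'
    · rw [hD]
      simp only [Set.indicator_of_mem h, Set.indicator_of_mem h', sub_self, abs_zero]
      exact Finset.sum_nonneg fun q _ => P.absAt_nonneg β (pt q) Λ
    · rw [hD]
      simp only [Set.indicator_of_mem h, Set.indicator_of_notMem h', zero_sub, abs_neg]
      obtain ⟨hc, hV, p, hp, hpD⟩ := h
      exact main Λ p hc hV hp fun hiff => h' ⟨hc, hV, p, hp, hiff.1 hpD⟩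
    · rw [hD]
      simp only [Set.indicator_of_notMem h, Set.indicator_of_mem h', sub_zero]
      obtain ⟨hc, hV, p, hp, hpD⟩ := h'
      exact main Λ p hc hV hp fun hiff => h ⟨hc, hV, p, hp, hiff.2 hpD⟩
    · rw [hD]
      simp only [Set.indicator_of_notMem h, Set.indicator_of_notMem h', sub_self, abs_zero]
      exact Finset.sum_nonneg fun q _ => P.absAt_nonneg β (pt q) Λ
  have hDs : Summable D := Summable.of_norm_bounded hsumm hbound
  have hdiff : |WInf P β N φ' - WInf P β N φ| ≤ |∑' Λ, D Λ| := by
    rw [hW, hW]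
    by_cases hs : Summable ((A φ).indicator (P.Φ β))
    · have hs' : Summable ((A φ').indicator (P.Φ β)) := by
        simpa [hD] using hDs.add hs
      rw [← hs'.tsum_sub hs]
    · have hs' : ¬ Summable ((A φ').indicator (P.Φ β)) := fun hs' => hs (by
        simpa [hD] using hs'.sub hDs)
      rw [tsum_eq_zero_of_not_summable hs, tsum_eq_zero_of_not_summable hs', sub_self, abs_zero]
      exact abs_nonneg _
  calc |WInf P β N φ' - WInf P β N φ| ≤ |∑' Λ, D Λ| := hdiff
    _ ≤ ∑' Λ, ∑ q ∈ I, P.absAt β (pt q) Λ := tsum_of_norm_bounded hsumm.hasSum hbound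
    _ = ∑ q ∈ I, ∑' Λ, P.absAt β (pt q) Λ :=
        Summable.tsum_finsetSum fun q _ => P.summable_absAt hβ (pt q)
    _ ≤ ∑ _q ∈ I, ∑' Λ, P.absAt β 0 Λ :=
        Finset.sum_le_sum fun q _ => P.tsum_absAt_le hβ (pt q)

theorem psiMap_upd {L : ℕ} (η : Cfg L) (i : Fin L) (k : Fin (L + 1)) :
    psiMap (upd η i 1) k = psiMap η k ∨ psiMap (upd η i 1) k = psiMap η k + 1 := by
  have : psiMap (upd η i 1) k = psiMap η k + if (i : ℕ) < k then 1 else 0 := by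
    have hi : (if (i : ℕ) < k then (1 : ℤ) else 0)
        = ∑ j : Fin L, if j = i then (if (j : ℕ) < k then 1 else 0) else 0 := by
      rw [Finset.sum_ite_eq' Finset.univ i, if_pos (Finset.mem_univ i)]
    rw [hi, psiMap, psiMap, ← Finset.sum_add_distrib]
    refine Finset.sum_congr rfl fun j _ => ?_
    rw [upd_apply]
    split_ifs <;> simp
  rw [this]
  split_ifs
  · exact Or.inr rfl
  · exact Or.inl (add_zero _)

theorem exists_nuHatW_le (P : Potential) {β : ℝ} (hβ : P.β₀ < β) {L : ℕ} (i : Fin L) :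
    ∃ C : ℝ, 0 ≤ C ∧ ∀ η, nuHatW P β L η ≤ C * nuHatW P β L (upd η i 1) := by
  obtain ⟨C, hC⟩ := exists_abs_WInf_sub_le P hβ (L + 1)
  refine ⟨Real.exp (β + C), (Real.exp_pos _).le, fun η => ?_⟩
  have hβ0 : 0 ≤ β := (P.β₀_pos.trans hβ).le
  have hW := (abs_le.1 (hC (psiMap η) (psiMap (upd η i 1)) (psiMap_upd η i))).2
  have hE : ∑ k : Fin L, |((upd η i 1 k : ℤ) : ℝ)| ≤ ∑ k : Fin L, |(η k : ℝ)| + 1 := by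
    have h1 : (1 : ℝ) = ∑ k : Fin L, if k = i then (1 : ℝ) else 0 := by simp
    rw [h1, ← Finset.sum_add_distrib]
    refine Finset.sum_le_sum fun k _ => ?_
    rw [upd_apply]
    push_cast
    refine (abs_add_le _ _).trans ?_
    split_ifs <;> simp
  rw [nuHatW, nuHatW, ← Real.exp_add, Real.exp_le_exp]
  nlinarith [mul_le_mul_of_nonneg_left hE hβ0]

/-- martingale decomposition identity:
`(δ_i^+ f_i)(η) = Ē_L(δ_i^+ f | η_{α_i}) + ∑_{j=1}^{i-1} Ē_L(f_j^+, V_{i,j} | η_{α_i})`,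
where `f_j = Ē_L(f | η_{α_j})`, `f_j^+(η) = f_j(η + δ_i)` and
`V_{i,j}(η) = ν̄_L(η_j | η_{α_{j+1}} + δ_i)/ν̄_L(η_j | η_{α_{j+1}}) − 1`. -/
theorem martingale_identity (P : Potential) (β : ℝ) (hβ : P.β₀ < β)
    (L : ℕ) (hL : 2 ≤ L) (hsum : Summable (nuHatW P β L))
    (i : Fin L) (hi : 0 < (i : ℕ)) (f : Cfg L → ℝ)
    (hf : Summable (fun η => nuHatW P β L η * (f η)^2)) (η : Cfg L) :
    condExp (nuHatW P β L) {l : Fin L | i ≤ l} f (upd η i 1) -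
      condExp (nuHatW P β L) {l : Fin L | i ≤ l} f η
    = condExp (nuHatW P β L) {l : Fin L | i ≤ l}
        (fun ζ => f (upd ζ i 1) - f ζ) η
      + ∑ j : Fin L, (if j < i then
          condCov (nuHatW P β L) {l : Fin L | i ≤ l}
            (fun ζ => condExp (nuHatW P β L) {l : Fin L | j ≤ l} f (upd ζ i 1))
            (fun ζ => condProbAbove (nuHatW P β L) j (ζ j) (upd ζ i 1) /
                      condProbAbove (nuHatW P β L) j (ζ j) ζ - 1) η
        else 0) := by
  obtain ⟨C, hC, hwC⟩ := exists_nuHatW_le P hβ i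
  have hw : ∀ ζ, 0 < nuHatW P β L ζ := fun ζ => Real.exp_pos _
  refine martingale_identity_of_weight hw hsum hC hwC ?_ η
  refine Summable.of_nonneg_of_le (fun ζ => mul_nonneg (hw ζ).le (abs_nonneg _)) (fun ζ => ?_)
    (hsum.add hf)
  have hsq : |f ζ| ≤ 1 + (f ζ) ^ 2 := by
    rw [← sq_abs]
    nlinarith [sq_nonneg (|f ζ| - 1), abs_nonneg (f ζ)]
  nlinarith [mul_le_mul_of_nonneg_left hsq (hw ζ).le]
end
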